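/- Let p(x) = Σ_{j=1}^{n-1} x_j²/a_j² − 1 with a_1, …, a_{n-1} > 0 (a polynomial in n variables not involving x_n). For every m ≥ 0, the Fischer operator F : P_m → P_m defined by F(q) = Δ(p·q) is a linear bijection of the space P_m of polynomials of degree at most m in n variables onto itself. -/

import Mathlib

open MvPolynomial Filter

/-- The Laplacian of a polynomial: `Δp = ∑ ∂²p/∂x_i²`. -/
noncomputable def polyLap {n : ℕ} (p : MvPolynomial (Fin n) ℝ) : MvPolynomial (Fin n) ℝ :=
  ∑ i, pderiv i (pderiv i p)

open MeasureTheory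

namespace MvPolynomial

section Derivatives

variable {σ R : Type*} [CommRing R]

lemma pderiv_pderiv_comm (i j : σ) (f : MvPolynomial σ R) :
    pderiv i (pderiv j f) = pderiv j (pderiv i f) := by
  have h : ⁅pderiv (R := R) i, pderiv (R := R) j⁆ = 0 := by
    classical
    refine derivation_ext fun k => ?_
    simp only [Derivation.commutator_apply, pderiv_X, Pi.single_apply, Derivation.zero_apply]
    split_ifs <;> simp
  simpa [Derivation.commutator_apply, sub_eq_zero] using DFunLike.congr_fun h f

lemma totalDegree_pderiv_le (i : σ) (f : MvPolynomial σ R) :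
    (pderiv i f).totalDegree ≤ f.totalDegree - 1 := by
  rw [totalDegree_eq]
  refine Finset.sup_le fun s hs => ?_
  have hs' : s + Finsupp.single i 1 ∈ f.support := by
    rw [mem_support_iff, coeff_pderiv] at hs
    exact mem_support_iff.2 (left_ne_zero_of_mul hs)
  have h : (s + Finsupp.single i 1).degree ≤ f.totalDegree := le_totalDegree hs'
  rw [map_add, Finsupp.degree_single] at h
  rw [Finsupp.card_toMultiset]
  change s.degree ≤ _
  omega

lemma homogeneousComponent_pderiv (d : ℕ) (i : σ) (f : MvPolynomial σ R) :
    homogeneousComponent d (pderiv i f) = pderiv i (homogeneousComponent (d + 1) f) := by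
  ext s
  simp only [coeff_homogeneousComponent, coeff_pderiv, map_add, Finsupp.degree_single,
    add_left_inj]
  split_ifs <;> simp

lemma IsHomogeneous.homogeneousComponent_mul {k : ℕ} {p : MvPolynomial σ R}
    (hp : p.IsHomogeneous k) (d : ℕ) (f : MvPolynomial σ R) :
    homogeneousComponent (k + d) (p * f) = p * homogeneousComponent d f := by
  let _ : GradedAlgebra (homogeneousSubmodule σ R) := gradedAlgebra
  have h := DirectSum.coe_decompose_mul_add_of_left_mem (homogeneousSubmodule σ R) (j := d)
    (b := f) ((mem_homogeneousSubmodule k p).2 hp)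
  rwa [show DirectSum.decompose (homogeneousSubmodule σ R) (p * f) =
      decomposition.decompose' (p * f) from rfl,
    show DirectSum.decompose (homogeneousSubmodule σ R) f = decomposition.decompose' f from rfl,
    decomposition.decompose'_apply, decomposition.decompose'_apply] at h

lemma homogeneousComponent_totalDegree_ne_zero {f : MvPolynomial σ R} (hf : f ≠ 0) :
    homogeneousComponent f.totalDegree f ≠ 0 := by
  obtain ⟨s, hs, hd⟩ := f.support.exists_mem_eq_sup (support_nonempty.2 hf)
    fun s => Multiset.card (Finsupp.toMultiset s)
  rw [← totalDegree_eq, Finsupp.card_toMultiset] at hd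
  change _ = s.degree at hd
  intro h
  have := congrArg (coeff s) h
  rw [coeff_homogeneousComponent, if_pos hd.symm, coeff_zero] at this
  exact mem_support_iff.1 hs this

end Derivatives

end MvPolynomial

section Laplacian

variable {n : ℕ}

lemma polyLap_add (f g : MvPolynomial (Fin n) ℝ) : polyLap (f + g) = polyLap f + polyLap g := by
  simp [polyLap, Finset.sum_add_distrib]

lemma polyLap_smul (c : ℝ) (f : MvPolynomial (Fin n) ℝ) : polyLap (c • f) = c • polyLap f := by
  simp [polyLap, Finset.smul_sum]

lemma polyLap_pderiv (i : Fin n) (f : MvPolynomial (Fin n) ℝ) :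
    polyLap (pderiv i f) = pderiv i (polyLap f) := by
  simp only [polyLap, map_sum, pderiv_pderiv_comm _ i]

lemma totalDegree_polyLap_le (f : MvPolynomial (Fin n) ℝ) :
    (polyLap f).totalDegree ≤ f.totalDegree - 2 := by
  refine totalDegree_finsetSum_le fun i _ => ?_
  have h₁ := totalDegree_pderiv_le i f
  have h₂ := totalDegree_pderiv_le i (pderiv i f)
  omega

lemma homogeneousComponent_polyLap (d : ℕ) (f : MvPolynomial (Fin n) ℝ) :
    homogeneousComponent d (polyLap f) = polyLap (homogeneousComponent (2 + d) f) := by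
  simp only [polyLap, map_sum, homogeneousComponent_pderiv, add_comm 2 d, add_assoc,
    Nat.reduceAdd]

end Laplacian

section GaussianMoments

lemma integrable_pow_mul_exp_neg_half_sq (k : ℕ) :
    Integrable fun x : ℝ => x ^ k * Real.exp (-(1 / 2) * x ^ 2) := by
  have h := integrable_rpow_mul_exp_neg_mul_sq (b := 1 / 2) (by norm_num) (s := k)
    (by linarith [Nat.cast_nonneg (α := ℝ) k])
  simpa only [Real.rpow_natCast] using h

lemma integral_pow_succ_mul_exp_neg_half_sq (k : ℕ) :
    ∫ x : ℝ, x ^ (k + 1) * Real.exp (-(1 / 2) * x ^ 2) =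
      k * ∫ x : ℝ, x ^ (k - 1) * Real.exp (-(1 / 2) * x ^ 2) := by
  have hd (x : ℝ) : HasDerivAt (fun x : ℝ => x ^ k * Real.exp (-(1 / 2) * x ^ 2))
      (k * (x ^ (k - 1) * Real.exp (-(1 / 2) * x ^ 2)) -
        x ^ (k + 1) * Real.exp (-(1 / 2) * x ^ 2)) x := by
    have h := (hasDerivAt_pow k x).mul (((hasDerivAt_pow 2 x).const_mul (-(1 / 2))).exp)
    convert! h using 1
    simp
    ring
  have h₁ := (integrable_pow_mul_exp_neg_half_sq (k - 1)).const_mul (k : ℝ)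
  have h₂ := integrable_pow_mul_exp_neg_half_sq (k + 1)
  have h := integral_eq_zero_of_hasDerivAt_of_integrable hd (h₁.sub h₂)
    (integrable_pow_mul_exp_neg_half_sq k)
  rw [integral_sub h₁ h₂, integral_const_mul] at h
  linarith

variable {σ : Type*} [Fintype σ]

lemma eval_monomial_mul_gaussianWeight (s : σ →₀ ℕ) (c : ℝ) (x : σ → ℝ) :
    eval x (monomial s c) * ∏ j, Real.exp (-(1 / 2) * x j ^ 2) =
      c * ∏ j, (x j ^ s j * Real.exp (-(1 / 2) * x j ^ 2)) := by
  rw [eval_monomial, Finsupp.prod_fintype _ _ (by simp), Finset.prod_mul_distrib, mul_assoc]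

lemma integrable_eval_mul_gaussianWeight (f : MvPolynomial σ ℝ) :
    Integrable fun x : σ → ℝ => eval x f * ∏ j, Real.exp (-(1 / 2) * x j ^ 2) := by
  induction f using MvPolynomial.induction_on' with
  | monomial s c =>
    simp_rw [eval_monomial_mul_gaussianWeight]
    exact (Integrable.fintype_prod (f := fun j (t : ℝ) => t ^ s j * Real.exp (-(1 / 2) * t ^ 2))
      fun j => integrable_pow_mul_exp_neg_half_sq (s j)).const_mul c
  | add f g hf hg => simpa only [map_add, add_mul] using! hf.add hg

/-- Integration of a polynomial against the (unnormalized) standard Gaussian weight. -/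
noncomputable def gaussianFunctional : MvPolynomial σ ℝ →ₗ[ℝ] ℝ where
  toFun f := ∫ x : σ → ℝ, eval x f * ∏ j, Real.exp (-(1 / 2) * x j ^ 2)
  map_add' f g := by
    simp only [map_add, add_mul]
    exact integral_add (integrable_eval_mul_gaussianWeight f)
      (integrable_eval_mul_gaussianWeight g)
  map_smul' c f := by
    simp only [smul_eval, mul_assoc, integral_const_mul, RingHom.id_apply, smul_eq_mul]

lemma gaussianFunctional_apply (f : MvPolynomial σ ℝ) :
    gaussianFunctional f = ∫ x : σ → ℝ, eval x f * ∏ j, Real.exp (-(1 / 2) * x j ^ 2) := rfl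

lemma gaussianFunctional_monomial (s : σ →₀ ℕ) (c : ℝ) :
    gaussianFunctional (monomial s c) =
      c * ∏ j, ∫ t : ℝ, t ^ s j * Real.exp (-(1 / 2) * t ^ 2) := by
  simp_rw [gaussianFunctional_apply, eval_monomial_mul_gaussianWeight, integral_const_mul]
  rw [integral_fintype_prod_volume_eq_prod
    (fun j (t : ℝ) => t ^ s j * Real.exp (-(1 / 2) * t ^ 2))]

lemma gaussianFunctional_X_mul (i : σ) (f : MvPolynomial σ ℝ) :
    gaussianFunctional (X i * f) = gaussianFunctional (pderiv i f) := by
  classical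
  induction f using MvPolynomial.induction_on' with
  | monomial s c =>
    rw [X, monomial_mul, pderiv_monomial, gaussianFunctional_monomial,
      gaussianFunctional_monomial, ← Finset.mul_prod_erase _ _ (Finset.mem_univ i),
      ← Finset.mul_prod_erase _ _ (Finset.mem_univ i)]
    have h : ∀ j ∈ Finset.univ.erase i,
        ∫ t : ℝ, t ^ ((Finsupp.single i 1 + s : σ →₀ ℕ) j) * Real.exp (-(1 / 2) * t ^ 2) =
        ∫ t : ℝ, t ^ ((s - Finsupp.single i 1 : σ →₀ ℕ) j) * Real.exp (-(1 / 2) * t ^ 2) := by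
      intro j hj
      have hj' := Finset.ne_of_mem_erase hj
      simp [Finsupp.single_eq_of_ne hj']
    rw [Finset.prod_congr rfl h]
    simp only [Finsupp.add_apply, Finsupp.tsub_apply, Finsupp.single_eq_same, add_comm 1 (s i),
      integral_pow_succ_mul_exp_neg_half_sq]
    ring
  | add f g hf hg => simp only [mul_add, map_add, hf, hg]

lemma gaussianFunctional_mul_self_nonneg (f : MvPolynomial σ ℝ) :
    0 ≤ gaussianFunctional (f * f) := by
  refine integral_nonneg fun x => ?_
  rw [eval_mul]
  have := mul_self_nonneg (eval x f)
  positivity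

lemma gaussianFunctional_mul_self_eq_zero {f : MvPolynomial σ ℝ}
    (h : gaussianFunctional (f * f) = 0) : f = 0 := by
  refine funext fun x => ?_
  rw [map_zero]
  by_contra hx
  refine (integral_pos_of_integrable_nonneg_nonzero (x := x) ?_
    (integrable_eval_mul_gaussianWeight (f * f)) (fun y => ?_) ?_).ne' h
  · exact (continuous_eval _).mul (by fun_prop)
  · rw [eval_mul]
    have := mul_self_nonneg (eval y f)
    simp only [Pi.zero_apply]
    positivity
  · rw [eval_mul]
    exact mul_ne_zero (mul_ne_zero hx hx) (Finset.prod_ne_zero_iff.2 fun j _ => Real.exp_ne_zero _)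

end GaussianMoments

section Harmonic

variable {n : ℕ}

lemma gaussianFunctional_eq_zero_of_harmonic {k : ℕ} {h : MvPolynomial (Fin n) ℝ}
    (hk : h.IsHomogeneous k) (h0 : 0 < k) (hh : polyLap h = 0) : gaussianFunctional h = 0 := by
  have e : (k : ℝ) • h = ∑ i, X i * pderiv i h := by
    rw [hk.sum_X_mul_pderiv, Nat.cast_smul_eq_nsmul]
  have : (k : ℝ) * gaussianFunctional h = 0 := by
    rw [← smul_eq_mul, ← map_smul, e, map_sum]
    simp_rw [gaussianFunctional_X_mul]
    rw [← map_sum]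
    exact (congrArg _ hh).trans (map_zero _)
  exact (mul_eq_zero.1 this).resolve_left (by positivity)

lemma gaussianFunctional_harmonic_mul_monomial (s : Fin n →₀ ℕ) {k : ℕ} (hs : s.degree < k)
    {h : MvPolynomial (Fin n) ℝ} (hk : h.IsHomogeneous k) (hh : polyLap h = 0) (c : ℝ) :
    gaussianFunctional (h * monomial s c) = 0 := by
  induction hd : s.degree using Nat.strong_induction_on generalizing s k h c with
  | _ d ih =>
    by_cases h0 : s = 0
    · subst h0
      rw [mul_comm, ← C_apply, C_mul', map_smul,
        gaussianFunctional_eq_zero_of_harmonic hk (by omega) hh, smul_zero]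
    · obtain ⟨i, hi⟩ := Finsupp.ne_iff.1 h0
      obtain ⟨t, rfl⟩ : ∃ t, s = Finsupp.single i 1 + t :=
        ⟨s - Finsupp.single i 1, (add_tsub_cancel_of_le
          (Finsupp.single_le_iff.2 (Nat.one_le_iff_ne_zero.2 hi))).symm⟩
      rw [map_add, Finsupp.degree_single] at hs hd
      have e : h * monomial (Finsupp.single i 1 + t) c = X i * (h * monomial t c) := by
        rw [X, mul_left_comm, monomial_mul, one_mul]
      have ht : (t - Finsupp.single i 1).degree ≤ t.degree :=
        Finsupp.degree_mono tsub_le_self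
      rw [e, gaussianFunctional_X_mul, pderiv_mul, map_add, pderiv_monomial,
        ih _ (by omega) t (k := k - 1) (by omega) hk.pderiv
          (by rw [polyLap_pderiv, hh, map_zero]) c rfl,
        ih _ (by omega) _ (k := k) (by omega) hk hh _ rfl, add_zero]

/-- A harmonic homogeneous polynomial is orthogonal to all polynomials of lower degree. -/
lemma gaussianFunctional_harmonic_mul {k : ℕ} {h q : MvPolynomial (Fin n) ℝ}
    (hk : h.IsHomogeneous k) (hh : polyLap h = 0) (hq : q.totalDegree < k) :
    gaussianFunctional (h * q) = 0 := by
  rw [q.as_sum, Finset.mul_sum, map_sum]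
  refine Finset.sum_eq_zero fun s hs => gaussianFunctional_harmonic_mul_monomial s ?_ hk hh _
  exact (show s.degree ≤ q.totalDegree from le_totalDegree hs).trans_lt hq

/-- A nontrivial sum of squares of linear forms does not divide a nonzero homogeneous harmonic
polynomial. -/
lemma eq_zero_of_polyLap_sum_sq_mul_eq_zero {ι : Type*} [Fintype ι] [Nonempty ι] (e : ι → Fin n)
    {c : ι → ℝ} (hc : ∀ j, 0 < c j) {d : ℕ} {q : MvPolynomial (Fin n) ℝ}
    (hq : q.IsHomogeneous d) (h : polyLap ((∑ j, C (c j) * X (e j) ^ 2) * q) = 0) : q = 0 := by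
  have hP : (∑ j, C (c j) * X (e j) ^ 2 : MvPolynomial (Fin n) ℝ).IsHomogeneous 2 :=
    IsHomogeneous.sum _ _ _ fun j _ => isHomogeneous_C_mul_X_pow _ _ _
  have h0 := gaussianFunctional_harmonic_mul (hP.mul hq) h
    (hq.totalDegree_le.trans_lt (by omega))
  have hsum : ∑ j, c j * gaussianFunctional ((X (e j) * q) * (X (e j) * q)) = 0 := by
    rw [← h0, Finset.sum_mul, Finset.sum_mul, map_sum]
    refine Finset.sum_congr rfl fun j _ => ?_
    rw [← smul_eq_mul, ← map_smul, ← C_mul']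
    congr 1
    ring
  rw [Finset.sum_eq_zero_iff_of_nonneg fun j _ =>
    mul_nonneg (hc j).le (gaussianFunctional_mul_self_nonneg _)] at hsum
  obtain ⟨j⟩ := ‹Nonempty ι›
  have hj := (mul_eq_zero.1 (hsum j (Finset.mem_univ j))).resolve_left (hc j).ne'
  exact (mul_eq_zero.1 (gaussianFunctional_mul_self_eq_zero hj)).resolve_left (X_ne_zero _)

end Harmonic

/-- The Fischer operator `q ↦ Δ(p·q)`, where `p = ∑_{j<n-1} x_j²/a_j² − 1` is the defining
polynomial of the ellipsoidal cylinder, is a linear bijection of the space of polynomials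
of total degree at most `m` onto itself. -/
theorem fischer_operator_bijective
    (n : ℕ) (hn : 2 ≤ n) (a : Fin (n - 1) → ℝ) (ha : ∀ j, 0 < a j) (m : ℕ) :
    ∃ T : MvPolynomial.restrictTotalDegree (Fin n) ℝ m →ₗ[ℝ]
        MvPolynomial.restrictTotalDegree (Fin n) ℝ m,
      (∀ q : MvPolynomial.restrictTotalDegree (Fin n) ℝ m,
        (T q : MvPolynomial (Fin n) ℝ) =
          polyLap (((∑ j : Fin (n - 1),
            C ((a j) ^ 2)⁻¹ * (X (Fin.castLE (Nat.sub_le n 1) j)) ^ 2) - 1) * (q : MvPolynomial (Fin n) ℝ))) ∧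
      Function.Bijective T := by
  set P : MvPolynomial (Fin n) ℝ := ∑ j : Fin (n - 1),
    C ((a j) ^ 2)⁻¹ * (X (Fin.castLE (Nat.sub_le n 1) j)) ^ 2 with hPdef
  have hP : P.IsHomogeneous 2 :=
    IsHomogeneous.sum _ _ _ fun j _ => isHomogeneous_C_mul_X_pow _ _ _
  have hdeg (q : MvPolynomial (Fin n) ℝ) (hq : q.totalDegree ≤ m) :
      (polyLap ((P - 1) * q)).totalDegree ≤ m := by
    have h₁ := totalDegree_polyLap_le ((P - 1) * q)
    have h₂ := totalDegree_mul (P - 1) q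
    have h₃ := totalDegree_sub P 1
    have h₄ := hP.totalDegree_le
    rw [totalDegree_one] at h₃
    omega
  let T : restrictTotalDegree (Fin n) ℝ m →ₗ[ℝ] restrictTotalDegree (Fin n) ℝ m :=
    { toFun := fun q => ⟨polyLap ((P - 1) * q),
        (mem_restrictTotalDegree _ _ _).2 (hdeg q ((mem_restrictTotalDegree _ _ _).1 q.2))⟩
      map_add' := fun q r => Subtype.ext (by simp [mul_add, polyLap_add])
      map_smul' := fun c q => Subtype.ext (by simp [polyLap_smul]) }
  have hT : Function.Injective T := by
    rw [← LinearMap.ker_eq_bot, LinearMap.ker_eq_bot']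
    rintro ⟨q, hq⟩ h
    have hq0 : polyLap ((P - 1) * q) = 0 := congrArg Subtype.val h
    refine Subtype.ext ?_
    by_contra hne
    have : Nonempty (Fin (n - 1)) := ⟨⟨0, by omega⟩⟩
    refine homogeneousComponent_totalDegree_ne_zero hne
      (eq_zero_of_polyLap_sum_sq_mul_eq_zero (Fin.castLE (Nat.sub_le n 1))
        (fun j => inv_pos.2 (pow_pos (ha j) 2)) (homogeneousComponent_isHomogeneous _ _) ?_)
    rw [← hPdef, ← hP.homogeneousComponent_mul]
    have h₁ := homogeneousComponent_polyLap q.totalDegree ((P - 1) * q)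
    rw [hq0, map_zero, sub_mul, one_mul, map_sub,
      homogeneousComponent_eq_zero (2 + q.totalDegree) q (by omega), sub_zero] at h₁
    exact h₁.symm
  exact ⟨T, fun _ => rfl, hT, LinearMap.injective_iff_surjective.1 hT⟩
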